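/- Let X be a topological space, f : X → X an open continuous map, and A ⊆ X with f(A) ⊆ A and f(X \ A) ⊆ X \ A. Let Å be the interior of A in closure(A). Then f(X \ Å) ⊆ X \ Å. -/

import Mathlib

/-- under the same hypotheses, `f` maps the complement of the
interior `Å = closure A \ closure (closure A \ A)` of `A` in `closure A`
into itself. -/
theorem stmt_6 {X : Type*} [TopologicalSpace X] (f : X → X)
    (hc : Continuous f) (ho : IsOpenMap f) (A : Set X)
    (h1 : f '' A ⊆ A) (h2 : f '' Aᶜ ⊆ Aᶜ) :
    f '' (closure A \ closure (closure A \ A))ᶜ ⊆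
      (closure A \ closure (closure A \ A))ᶜ := by
  have hA : f ⁻¹' A = A := by
    ext x
    constructor
    · intro hx
      by_contra hn
      exact h2 ⟨x, hn, rfl⟩ hx
    · intro hx
      exact h1 ⟨x, hx, rfl⟩
  have key : f ⁻¹' (closure A \ closure (closure A \ A)) =
      closure A \ closure (closure A \ A) := by
    rw [Set.preimage_diff, ho.preimage_closure_eq_closure_preimage hc,
      ho.preimage_closure_eq_closure_preimage hc, Set.preimage_diff,
      ho.preimage_closure_eq_closure_preimage hc, hA]
  rintro _ ⟨x, hx, rfl⟩ hfx
  apply hx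
  rw [← key]
  exact hfx
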